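/- Let ζ₀ be a probability measure on ℝ with zero mean and finite second moment m₂, let g be an independent centered Gaussian with variance 2/N, and for t > 0 set γ = 1 − e^{−t} and let ζ_t be the law of √(1−γ)·X₀ + √γ·G where X₀ ~ ζ₀ and G ~ g. Then the relative entropy satisfies S(ζ_t | g_{2/N}) ≤ N·m₂(ζ₀) − log(1 − e^{−t}). -/

import Mathlib

open MeasureTheory ProbabilityTheory

open scoped ENNReal NNReal

/-- Integrating a function of `A + Z` against the reciprocal of the density of the independent
Gaussian noise `Z` gives its Lebesgue integral. -/
lemma lintegral_comp_add_div_gaussianPDF {Ω : Type*} [MeasurableSpace Ω] {P : Measure Ω}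
    [IsProbabilityMeasure P] {A Z : Ω → ℝ} (hA : Measurable A) (hZ : Measurable Z)
    (hindep : IndepFun A Z P) {w : ℝ≥0} (hw : w ≠ 0) (hZlaw : P.map Z = gaussianReal 0 w)
    {Φ : ℝ → ℝ≥0∞} (hΦ : Measurable Φ) :
    ∫⁻ ω, Φ (A ω + Z ω) / gaussianPDF 0 w (Z ω) ∂P = ∫⁻ x, Φ x := by
  have hjoint : P.map (fun ω => (A ω, Z ω)) = (P.map A).prod (gaussianReal 0 w) := by
    rw [← hZlaw]
    exact (indepFun_iff_map_prod_eq_prod_map_map hA.aemeasurable hZ.aemeasurable).1 hindep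
  have hp := measurable_gaussianPDF 0 w
  have hF : Measurable (fun q : ℝ × ℝ => Φ (q.1 + q.2) / gaussianPDF 0 w q.2) := by fun_prop
  have := Measure.isProbabilityMeasure_map (μ := P) hA.aemeasurable
  rw [← lintegral_map (f := fun q : ℝ × ℝ => Φ (q.1 + q.2) / gaussianPDF 0 w q.2) hF
    (hA.prodMk hZ), hjoint, lintegral_prod _ hF.aemeasurable]
  have hinner (a : ℝ) :
      ∫⁻ z, Φ (a + z) / gaussianPDF 0 w z ∂(gaussianReal 0 w) = ∫⁻ x, Φ x := by
    rw [gaussianReal_of_var_ne_zero _ hw,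
      lintegral_withDensity_eq_lintegral_mul _ hp (by fun_prop),
      ← lintegral_add_left_eq_self Φ a]
    refine lintegral_congr fun z => ?_
    simp only [Pi.mul_apply]
    exact ENNReal.mul_div_cancel (gaussianPDF_pos 0 hw z).ne' gaussianPDF_ne_top
  simp [hinner]

lemma log_gaussianPDFReal (m : ℝ) {v : ℝ≥0} (hv : v ≠ 0) (x : ℝ) :
    Real.log (gaussianPDFReal m v x)
      = -(Real.log (2 * Real.pi * v) / 2) - (x - m) ^ 2 / (2 * v) := by
  have hv' : (0 : ℝ) < v := by positivity
  rw [gaussianPDFReal, Real.log_mul (by positivity) (by positivity), Real.log_inv,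
    Real.log_sqrt (by positivity), Real.log_exp]
  ring

/-- The law of a random variable plus an independent nondegenerate Gaussian noise is absolutely
continuous with respect to any nondegenerate Gaussian. -/
lemma map_add_absolutelyContinuous_gaussianReal {Ω : Type*} [MeasurableSpace Ω] {P : Measure Ω}
    [IsProbabilityMeasure P] {A Z : Ω → ℝ} (hA : Measurable A) (hZ : Measurable Z)
    (hindep : IndepFun A Z P) {v w : ℝ≥0} (hv : v ≠ 0) (hw : w ≠ 0)
    (hZlaw : P.map Z = gaussianReal 0 w) :
    P.map (fun ω => A ω + Z ω) ≪ gaussianReal 0 v := by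
  have h : P.map (A + Z) ≪ gaussianReal 0 v := by
    rw [hindep.map_add_eq_map_conv_map₀ hA.aemeasurable hZ.aemeasurable, hZlaw]
    exact (Measure.conv_absolutelyContinuous (gaussianReal_absolutelyContinuous 0 hw)).trans
      (gaussianReal_absolutelyContinuous' 0 hv)
  exact h

/-- By convexity, the relative entropy with respect to `N(0, v)` of the law of `A + Z`, with
`Z ∼ N(0, w)` independent of `A`, is at most the mean relative entropy of `N(A, w)`. -/
lemma integral_llr_map_add_gaussian_le {Ω : Type*} [MeasurableSpace Ω] {P : Measure Ω}
    [IsProbabilityMeasure P] {A Z : Ω → ℝ} (hA : Measurable A) (hZ : Measurable Z)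
    (hindep : IndepFun A Z P) {v w : ℝ≥0} (hv : v ≠ 0) (hw : w ≠ 0)
    (hZlaw : P.map Z = gaussianReal 0 w) (hA2 : Integrable (fun ω => A ω ^ 2) P)
    (hint : Integrable (llr (P.map (fun ω => A ω + Z ω)) (gaussianReal 0 v))
      (P.map (fun ω => A ω + Z ω))) :
    ∫ x, llr (P.map (fun ω => A ω + Z ω)) (gaussianReal 0 v) x ∂(P.map (fun ω => A ω + Z ω))
      ≤ (Real.log (v / w) + (∫ ω, A ω ^ 2 ∂P + w) / v - 1) / 2 := by
  have hv' : (0 : ℝ) < v := by positivity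
  have hw' : (0 : ℝ) < w := by positivity
  have hY : Measurable (fun ω => A ω + Z ω) := hA.add hZ
  have hac := map_add_absolutelyContinuous_gaussianReal hA hZ hindep hv hw hZlaw
  set μ := P.map (fun ω => A ω + Z ω) with hμ
  have hprob : IsProbabilityMeasure μ := Measure.isProbabilityMeasure_map hY.aemeasurable
  set r := μ.rnDeriv (gaussianReal 0 v) with hr
  have hrm : Measurable r := Measure.measurable_rnDeriv _ _
  -- moments of the noise
  have hALp : MemLp A 2 P := (memLp_two_iff_integrable_sq hA.aestronglyMeasurable).2 hA2
  have hZLp : MemLp Z 2 P := by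
    have := memLp_id_gaussianReal (μ := 0) (v := w) 2
    rw [← hZlaw, memLp_map_measure_iff (by fun_prop) hZ.aemeasurable] at this
    exact this
  have hZ0 : ∫ ω, Z ω ∂P = 0 := by
    have := integral_id_gaussianReal (μ := 0) (v := w)
    rwa [← hZlaw, integral_map hZ.aemeasurable (by fun_prop)] at this
  have hZ2 : Integrable (fun ω => Z ω ^ 2) P := hZLp.integrable_sq
  have hZvar : ∫ ω, Z ω ^ 2 ∂P = w := by
    have h1 := variance_fun_id_gaussianReal (μ := 0) (v := w)
    rw [variance_of_integral_eq_zero (by fun_prop) integral_id_gaussianReal, ← hZlaw,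
      integral_map hZ.aemeasurable (by fun_prop)] at h1
    exact h1
  have hAZ : Integrable (fun ω => A ω * Z ω) P := hALp.integrable_mul hZLp
  have hAZ0 : ∫ ω, A ω * Z ω ∂P = 0 := by
    rw [hindep.integral_fun_mul_eq_mul_integral hA.aestronglyMeasurable
      hZ.aestronglyMeasurable, hZ0, mul_zero]
  -- the remainder term has mean at most one
  set W : Ω → ℝ := fun ω =>
    (r (A ω + Z ω)).toReal * gaussianPDFReal 0 v (A ω + Z ω) / gaussianPDFReal 0 w (Z ω) with hW
  have hWm : Measurable W := by
    have := measurable_gaussianPDFReal 0 v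
    have := measurable_gaussianPDFReal 0 w
    fun_prop
  have hW0 (ω : Ω) : 0 ≤ W ω :=
    div_nonneg (mul_nonneg ENNReal.toReal_nonneg (gaussianPDFReal_nonneg _ _ _))
      (gaussianPDFReal_nonneg _ _ _)
  have hWle : ∫⁻ ω, ENNReal.ofReal (W ω) ∂P ≤ 1 := by
    calc ∫⁻ ω, ENNReal.ofReal (W ω) ∂P
        ≤ ∫⁻ ω, (fun x => gaussianPDF 0 v x * r x) (A ω + Z ω) / gaussianPDF 0 w (Z ω) ∂P := by
          refine lintegral_mono fun ω => ?_
          simp only [hW]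
          rw [ENNReal.ofReal_div_of_pos (gaussianPDFReal_pos 0 w _ hw),
            ENNReal.ofReal_mul ENNReal.toReal_nonneg, mul_comm]
          unfold gaussianPDF
          gcongr
          exact ENNReal.ofReal_toReal_le
      _ = ∫⁻ x, gaussianPDF 0 v x * r x :=
          lintegral_comp_add_div_gaussianPDF hA hZ hindep hw hZlaw
            ((measurable_gaussianPDF 0 v).mul hrm)
      _ = ∫⁻ x, r x ∂(gaussianReal 0 v) := by
          rw [gaussianReal_of_var_ne_zero _ hv,
            lintegral_withDensity_eq_lintegral_mul _ (measurable_gaussianPDF 0 v) hrm]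
          rfl
      _ ≤ 1 := by
          rw [hr, Measure.lintegral_rnDeriv hac]
          exact prob_le_one
  have hWint : Integrable W P := by
    refine ⟨hWm.aestronglyMeasurable, ?_⟩
    rw [hasFiniteIntegral_iff_ofReal (Filter.Eventually.of_forall hW0)]
    exact hWle.trans_lt ENNReal.one_lt_top
  have hWone : ∫ ω, W ω ∂P ≤ 1 := by
    rw [integral_eq_lintegral_of_nonneg_ae (Filter.Eventually.of_forall hW0)
      hWm.aestronglyMeasurable]
    exact ENNReal.toReal_le_of_le_ofReal zero_le_one (by simpa using hWle)
  -- pointwise Gibbs inequality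
  have hrpos : ∀ᵐ ω ∂P, 0 < r (A ω + Z ω) :=
    ae_of_ae_map hY.aemeasurable (Measure.rnDeriv_pos hac)
  have hrfin : ∀ᵐ ω ∂P, r (A ω + Z ω) < ∞ :=
    ae_of_ae_map hY.aemeasurable (hac.ae_le (Measure.rnDeriv_lt_top μ (gaussianReal 0 v)))
  have hpt : ∀ᵐ ω ∂P, Real.log (r (A ω + Z ω)).toReal ≤
      (Real.log (v / w) / 2 - 1) + (1 / (2 * v)) * (A ω ^ 2) + (1 / v) * (A ω * Z ω)
        + (1 / (2 * v) - 1 / (2 * w)) * Z ω ^ 2 + W ω := by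
    filter_upwards [hrpos, hrfin] with ω h0 h1
    have hR : 0 < (r (A ω + Z ω)).toReal := ENNReal.toReal_pos h0.ne' h1.ne
    have hpv := gaussianPDFReal_pos 0 v (A ω + Z ω) hv
    have hpw := gaussianPDFReal_pos 0 w (Z ω) hw
    have hlog := Real.log_le_sub_one_of_pos (x := W ω) (by simp only [hW]; positivity)
    have hWlog : Real.log (W ω) = Real.log (r (A ω + Z ω)).toReal
        + Real.log (gaussianPDFReal 0 v (A ω + Z ω)) - Real.log (gaussianPDFReal 0 w (Z ω)) := by
      simp only [hW]
      rw [Real.log_div (by positivity) hpw.ne', Real.log_mul hR.ne' hpv.ne']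
    rw [hWlog, log_gaussianPDFReal 0 hv, log_gaussianPDFReal 0 hw,
      Real.log_mul (by positivity) hv'.ne', Real.log_mul (by positivity) hw'.ne'] at hlog
    rw [Real.log_div hv'.ne' hw'.ne']
    have e1 : (A ω + Z ω - 0) ^ 2 / (2 * v) = (1 / (2 * v)) * (A ω ^ 2) + (1 / v) * (A ω * Z ω)
        + (1 / (2 * v)) * Z ω ^ 2 := by
      field_simp
      ring
    have e2 : (Z ω - 0) ^ 2 / (2 * w) = (1 / (2 * w)) * Z ω ^ 2 := by
      field_simp
      ring
    rw [e1, e2] at hlog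
    linarith
  have hllr : ∫ x, llr μ (gaussianReal 0 v) x ∂μ = ∫ ω, Real.log (r (A ω + Z ω)).toReal ∂P := by
    rw [hμ, integral_map hY.aemeasurable (by fun_prop)]
    rfl
  have hlint : Integrable (fun ω => Real.log (r (A ω + Z ω)).toReal) P :=
    hint.comp_measurable hY
  rw [hllr]
  have i1 : Integrable (fun ω => (Real.log (v / w) / 2 - 1) + (1 / (2 * v)) * (A ω ^ 2)) P :=
    (integrable_const _).add (hA2.const_mul _)
  have i2 : Integrable (fun ω => (Real.log (v / w) / 2 - 1) + (1 / (2 * v)) * (A ω ^ 2)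
      + (1 / v) * (A ω * Z ω)) P := i1.add (hAZ.const_mul _)
  have i3 : Integrable (fun ω => (Real.log (v / w) / 2 - 1) + (1 / (2 * v)) * (A ω ^ 2)
      + (1 / v) * (A ω * Z ω) + (1 / (2 * v) - 1 / (2 * w)) * Z ω ^ 2) P :=
    i2.add (hZ2.const_mul _)
  refine (integral_mono_ae hlint (i3.add hWint) hpt).trans ?_
  simp only [Pi.add_apply]
  rw [integral_add i3 hWint, integral_add i2 (hZ2.const_mul _),
    integral_add i1 (hAZ.const_mul _), integral_add (integrable_const _) (hA2.const_mul _)]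
  simp only [integral_const_mul, integral_const, hAZ0, hZvar, probReal_univ, one_smul]
  have e : (Real.log (v / w) / 2 - 1) + (1 / (2 * v)) * (∫ ω, A ω ^ 2 ∂P) + (1 / v) * 0
      + (1 / (2 * v) - 1 / (2 * w)) * (w : ℝ) + 1
      = (Real.log (v / w) + (∫ ω, A ω ^ 2 ∂P + w) / v - 1) / 2 := by
    field_simp
    ring
  linarith

theorem stmt_14 {Ω : Type*} [MeasurableSpace Ω] (P : Measure Ω) [IsProbabilityMeasure P]
    (N : ℝ) (hN : 0 < N) (t : ℝ) (ht : 0 < t)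
    (X₀ G : Ω → ℝ) (hX₀ : Measurable X₀) (hG : Measurable G)
    (hindep : IndepFun X₀ G P)
    (hGlaw : P.map G = gaussianReal 0 (Real.toNNReal (2 / N)))
    (hmean : ∫ ω, X₀ ω ∂P = 0)
    (hm2 : Integrable (fun ω => X₀ ω ^ 2) P) :
    ∫ x, Real.log (((P.map (fun ω => Real.sqrt (Real.exp (-t)) * X₀ ω
          + Real.sqrt (1 - Real.exp (-t)) * G ω)).rnDeriv
        (gaussianReal 0 (Real.toNNReal (2 / N)))) x).toReal
      ∂(P.map (fun ω => Real.sqrt (Real.exp (-t)) * X₀ ω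
          + Real.sqrt (1 - Real.exp (-t)) * G ω))
      ≤ N * (∫ ω, X₀ ω ^ 2 ∂P) - Real.log (1 - Real.exp (-t)) := by
  have hc0 : 0 < Real.exp (-t) := Real.exp_pos _
  have hc1 : Real.exp (-t) < 1 := Real.exp_lt_one_iff.2 (by linarith)
  set c := Real.exp (-t)
  have hm0 : 0 ≤ ∫ ω, X₀ ω ^ 2 ∂P := integral_nonneg fun ω => sq_nonneg _
  have hlog : Real.log (1 - c) ≤ 0 := Real.log_nonpos (by linarith) (by linarith)
  set v : ℝ≥0 := Real.toNNReal (2 / N) with hvdef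
  have hvpos : 0 < v := Real.toNNReal_pos.2 (by positivity)
  have hvN : (v : ℝ) = 2 / N := Real.coe_toNNReal _ (by positivity)
  set γ : ℝ≥0 := .mk (√(1 - c) ^ 2) (sq_nonneg _) with hγdef
  have hγ : (γ : ℝ) = 1 - c := Real.sq_sqrt (by linarith)
  have hγpos : 0 < γ := by
    rw [← NNReal.coe_pos, hγ]
    linarith
  have hZlaw : P.map (fun ω => √(1 - c) * G ω) = gaussianReal 0 (γ * v) := by
    have := (gaussianReal_const_mul ⟨hG.aemeasurable, hGlaw⟩ (√(1 - c))).map_eq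
    rwa [mul_zero] at this
  have hsq (ω : Ω) : (√c * X₀ ω) ^ 2 = c * X₀ ω ^ 2 := by
    rw [mul_pow, Real.sq_sqrt hc0.le]
  have hind : IndepFun (fun ω => √c * X₀ ω) (fun ω => √(1 - c) * G ω) P :=
    hindep.comp (measurable_const_mul (√c)) (measurable_const_mul (√(1 - c)))
  by_cases hint : Integrable
      (llr (P.map (fun ω => √c * X₀ ω + √(1 - c) * G ω)) (gaussianReal 0 v))
      (P.map (fun ω => √c * X₀ ω + √(1 - c) * G ω))
  · have key := integral_llr_map_add_gaussian_le (hX₀.const_mul (√c)) (hG.const_mul (√(1 - c)))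
      hind hvpos.ne' (mul_pos hγpos hvpos).ne' hZlaw (by simpa only [hsq] using hm2.const_mul c)
      hint
    refine le_trans key ?_
    have hv' : (v : ℝ) ≠ 0 := by positivity
    have hγ' : (γ : ℝ) ≠ 0 := by positivity
    simp only [hsq, integral_const_mul, NNReal.coe_mul]
    have e1 : (v : ℝ) / (γ * v) = (γ : ℝ)⁻¹ := by field_simp
    have e2 : (c * (∫ ω, X₀ ω ^ 2 ∂P) + γ * v) / (v : ℝ)
        = c * (N * ∫ ω, X₀ ω ^ 2 ∂P) / 2 + γ := by
      rw [add_div, mul_div_cancel_right₀ _ hv', hvN]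
      field_simp
    rw [e1, e2, Real.log_inv, hγ]
    have hb : c * (N * ∫ ω, X₀ ω ^ 2 ∂P) ≤ 1 * (N * ∫ ω, X₀ ω ^ 2 ∂P) :=
      mul_le_mul_of_nonneg_right hc1.le (by positivity)
    have : 0 ≤ N * ∫ ω, X₀ ω ^ 2 ∂P := by positivity
    linarith
  · have h0 := integral_undef hint
    simp only [llr] at h0
    rw [h0]
    have : 0 ≤ N * ∫ ω, X₀ ω ^ 2 ∂P := by positivity
    linarith
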